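/- arXiv:1904.11188 — 2 statements merged into one kernel-verified Lean document; each statement's English description precedes it below -/
import Mathlib

section
/- For probability distributions p, q on a finite alphabet X = {1,…,n} with supp(p) ⊆ supp(q), and families of m×m density matrices (ρ_x)_{x∈X}, (σ_x)_{x∈X} such that supp(ρ_x) ⊆ supp(σ_x) whenever p_x > 0, one has D(p‖q) + Σ_x p_x D(ρ_x‖σ_x) ≥ D(ρ‖σ), where ρ = Σ_x p_x ρ_x and σ = Σ_x q_x σ_x. Equivalently, −D(p‖q) + Σ_x p_x Tr{ρ_x[log σ_x − log σ]} ≤ Σ_x p_x Tr{ρ_x[log ρ_x − log ρ]}, with equality when q = p and σ_x = ρ_x for all x with p_x > 0. -/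
open Matrix Finset Filter ComplexOrder

/-- Matrix logarithm on the support: for a Hermitian matrix, apply `Real.log`
to the eigenvalues (note `Real.log 0 = 0`, giving the logarithm on the support);
junk value `0` otherwise. -/
noncomputable def mlog {k : ℕ} (A : Matrix (Fin k) (Fin k) ℂ) : Matrix (Fin k) (Fin k) ℂ :=
  if h : A.IsHermitian then
    (h.eigenvectorUnitary : Matrix (Fin k) (Fin k) ℂ) *
      Matrix.diagonal (fun i => (Real.log (h.eigenvalues i) : ℂ)) *
      (star (h.eigenvectorUnitary : Matrix (Fin k) (Fin k) ℂ))
  else 0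

/-- A density matrix: positive semidefinite with unit trace. -/
def IsDensity {k : ℕ} (ρ : Matrix (Fin k) (Fin k) ℂ) : Prop :=
  ρ.PosSemidef ∧ ρ.trace = 1

/-- A probability distribution on `Fin k`. -/
def IsDist {k : ℕ} (p : Fin k → ℝ) : Prop :=
  (∀ x, 0 ≤ p x) ∧ ∑ x, p x = 1

/-- `supp ρ ⊆ supp σ`, expressed as `ker σ ⊆ ker ρ`. -/
def SuppLE {k : ℕ} (ρ σ : Matrix (Fin k) (Fin k) ℂ) : Prop :=
  ∀ v, σ.mulVec v = 0 → ρ.mulVec v = 0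

/-- Quantum relative entropy `D(ρ‖σ) = Tr[ρ(log ρ − log σ)]` (natural log). -/
noncomputable def qRelEnt {k : ℕ} (ρ σ : Matrix (Fin k) (Fin k) ℂ) : ℝ :=
  (Matrix.trace (ρ * (mlog ρ - mlog σ))).re

/-- Von Neumann entropy `H(ρ) = −Tr(ρ log ρ)` (natural log). -/
noncomputable def vN {k : ℕ} (ρ : Matrix (Fin k) (Fin k) ℂ) : ℝ :=
  -(Matrix.trace (ρ * mlog ρ)).re

/-- Classical relative entropy `D(p‖q)`. -/
noncomputable def cRelEnt {k : ℕ} (p q : Fin k → ℝ) : ℝ :=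
  ∑ x, p x * (Real.log (p x) - Real.log (q x))

/-- Holevo quantity `χ(p) = H(Σ_x p_x ρ_x) − Σ_x p_x H(ρ_x)`. -/
noncomputable def holevo {n m : ℕ} (ρ : Fin n → Matrix (Fin m) (Fin m) ℂ)
    (p : Fin n → ℝ) : ℝ :=
  vN (∑ x, (p x : ℂ) • ρ x) - ∑ x, p x * vN (ρ x)

/-- `f_λ(p, p') = Σ_x Tr{p_x ρ_x [log(p'_x ρ_x) − log(p_x ρ')]} − λ sᵀp`,
where `ρ' = Σ_x p'_x ρ_x`. -/
noncomputable def fBA {n m : ℕ} (ρ : Fin n → Matrix (Fin m) (Fin m) ℂ)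
    (s : Fin n → ℝ) (lam : ℝ) (p p' : Fin n → ℝ) : ℝ :=
  (∑ x, (Matrix.trace (((p x : ℂ) • ρ x) *
      (mlog ((p' x : ℂ) • ρ x) - mlog ((p x : ℂ) • ∑ y, (p' y : ℂ) • ρ y)))).re)
    - lam * ∑ x, s x * p x

/-- `r_x = exp(Tr{ρ_x[log(p_x ρ_x) − log ρ̄]} − λ s_x)` with `ρ̄ = Σ_y p_y ρ_y`. -/
noncomputable def rBA {n m : ℕ} (ρ : Fin n → Matrix (Fin m) (Fin m) ℂ)
    (s : Fin n → ℝ) (lam : ℝ) (p : Fin n → ℝ) (x : Fin n) : ℝ :=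
  Real.exp ((Matrix.trace (ρ x *
      (mlog ((p x : ℂ) • ρ x) - mlog (∑ y, (p y : ℂ) • ρ y)))).re - lam * s x)

/-- One Blahut–Arimoto update step. -/
noncomputable def baStep {n m : ℕ} (ρ : Fin n → Matrix (Fin m) (Fin m) ℂ)
    (s : Fin n → ℝ) (lam : ℝ) (p : Fin n → ℝ) (x : Fin n) : ℝ :=
  rBA ρ s lam p x / ∑ y, rBA ρ s lam p y

/-- The Blahut–Arimoto iterates starting from `p0`. -/
noncomputable def baSeq {n m : ℕ} (ρ : Fin n → Matrix (Fin m) (Fin m) ℂ)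
    (s : Fin n → ℝ) (lam : ℝ) (p0 : Fin n → ℝ) : ℕ → Fin n → ℝ
  | 0 => p0
  | t + 1 => baStep ρ s lam (baSeq ρ s lam p0 t)

section Scalar

/-- An antiderivative in `t` of `(a - b)² / ((b + t a) (1 + t)²)`. -/
noncomputable def relEntPrimitive (a b t : ℝ) : ℝ :=
  a * Real.log (b + t * a) - a * Real.log (1 + t) - (b - a) / (1 + t)

theorem hasDerivAt_relEntPrimitive {a b t : ℝ} (ht : 0 ≤ t) (h : 0 < b + t * a) :
    HasDerivAt (relEntPrimitive a b) ((a - b) ^ 2 / (b + t * a) / (1 + t) ^ 2) t := by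
  have h1 : (1 + t) ≠ 0 := by positivity
  have e1 : HasDerivAt (fun t : ℝ => b + t * a) a t := by
    simpa using ((hasDerivAt_id t).mul_const a).const_add b
  have e2 : HasDerivAt (fun t : ℝ => 1 + t) 1 t := (hasDerivAt_id t).const_add 1
  have := (((e1.log h.ne').const_mul a).sub ((e2.log h1).const_mul a)).sub
    ((hasDerivAt_const t (b - a)).div e2 h1)
  refine this.congr_deriv ?_
  obtain ⟨c, rfl⟩ : ∃ c, b = c - t * a := ⟨b + t * a, by ring⟩
  rw [sub_add_cancel] at h ⊢
  field_simp
  ring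

theorem tendsto_relEntPrimitive {a b : ℝ} (ha : 0 ≤ a) :
    Tendsto (relEntPrimitive a b) atTop (nhds (a * Real.log a)) := by
  have hinv : Tendsto (fun t : ℝ => (1 + t)⁻¹) atTop (nhds 0) :=
    tendsto_inv_atTop_zero.comp (tendsto_atTop_add_const_left _ _ tendsto_id)
  rcases ha.eq_or_lt with rfl | ha
  · have := hinv.const_mul (-b)
    simp only [mul_zero] at this
    refine (this.congr fun t => ?_).trans (by simp)
    simp [relEntPrimitive, div_eq_mul_inv]
  · have hq : Tendsto (fun t : ℝ => (b + t * a) / (1 + t)) atTop (nhds a) := by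
      have := (hinv.const_mul (b - a)).const_add a
      simp only [mul_zero, add_zero] at this
      refine this.congr' ?_
      filter_upwards [eventually_gt_atTop 0] with t ht
      field_simp
      ring
    have := ((hq.log ha.ne').const_mul a).sub (hinv.const_mul (b - a))
    simp only [mul_zero, sub_zero] at this
    refine this.congr' ?_
    filter_upwards [eventually_gt_atTop 0, eventually_gt_atTop (-b / a)] with t ht ht'
    have h1 : 0 < b + t * a := by
      rw [div_lt_iff₀ ha] at ht'
      linarith
    rw [Real.log_div h1.ne' (by positivity), relEntPrimitive, div_eq_mul_inv]
    ring

theorem relEntPrimitive_zero (a b : ℝ) :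
    relEntPrimitive a b 0 = a * Real.log b - b + a := by
  simp [relEntPrimitive]
  ring

end Scalar

section Spectral

variable {ι κ : Type*} [Fintype ι] [DecidableEq ι] [Fintype κ]

/-- The matrix with eigenvalues `a` and eigenbasis the columns of `U`. -/
noncomputable def ofSpectrum (U : Matrix ι ι ℂ) (a : ι → ℝ) : Matrix ι ι ℂ :=
  U * diagonal (fun i => (a i : ℂ)) * Uᴴ

/-- The transition probabilities between two orthonormal bases. -/
noncomputable def overlap (U V : Matrix ι ι ℂ) (i j : ι) : ℝ :=
  Complex.normSq ((Uᴴ * V) i j)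

/-- The relative entropy expressed through spectral decompositions. -/
noncomputable def specRelEnt (U : Matrix ι ι ℂ) (a : ι → ℝ) (V : Matrix ι ι ℂ) (b : ι → ℝ) : ℝ :=
  ∑ i, ∑ j, overlap U V i j * (a i * (Real.log (a i) - Real.log (b j)))

/-- The quadratic divergence whose weighted integral over `t` is the relative entropy. -/
noncomputable def specQuad (U : Matrix ι ι ℂ) (a : ι → ℝ) (V : Matrix ι ι ℂ) (b : ι → ℝ)
    (t : ℝ) : ℝ :=
  ∑ i, ∑ j, overlap U V i j * ((a i - b j) ^ 2 / (b j + t * a i))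

/-- The functional, linear in `(A, B)`, whose supremum over `X` is the quadratic divergence. -/
noncomputable def dualQuad (A B X : Matrix ι ι ℂ) (t : ℝ) : ℝ :=
  2 * (trace (Xᴴ * (A - B))).re - (trace (X * B * Xᴴ)).re - t * (trace (Xᴴ * A * X)).re

omit [DecidableEq ι] in
theorem dualQuad_sum (A B : κ → Matrix ι ι ℂ) (X : Matrix ι ι ℂ) (t : ℝ) :
    dualQuad (∑ x, A x) (∑ x, B x) X t = ∑ x, dualQuad (A x) (B x) X t := by
  simp only [dualQuad, ← Finset.sum_sub_distrib, Matrix.sum_mul, trace_sum,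
    Complex.re_sum, Finset.mul_sum]

omit [DecidableEq ι] in
theorem overlap_nonneg (U V : Matrix ι ι ℂ) (i j : ι) : 0 ≤ overlap U V i j :=
  Complex.normSq_nonneg _

theorem sum_overlap_right {U V : Matrix ι ι ℂ} (hU : U ∈ unitaryGroup ι ℂ)
    (hV : V ∈ unitaryGroup ι ℂ) (i : ι) : ∑ j, overlap U V i j = 1 := by
  have hU' : Uᴴ * U = 1 := mem_unitaryGroup_iff'.1 hU
  have hV' : V * Vᴴ = 1 := mem_unitaryGroup_iff.1 hV
  have h : (Uᴴ * V) * (Uᴴ * V)ᴴ = 1 := by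
    rw [conjTranspose_mul, conjTranspose_conjTranspose, Matrix.mul_assoc, ← Matrix.mul_assoc V,
      hV', Matrix.one_mul, hU']
  have h' := congrFun (congrFun h i) i
  rw [mul_apply, one_apply_eq] at h'
  have := congrArg Complex.re h'
  simpa [overlap, Complex.mul_conj] using this

omit [DecidableEq ι] in
theorem overlap_comm (U V : Matrix ι ι ℂ) (i j : ι) : overlap U V i j = overlap V U j i := by
  have h : Vᴴ * U = (Uᴴ * V)ᴴ := by simp
  rw [overlap, overlap, h, conjTranspose_apply]
  exact (Complex.normSq_conj _).symm

theorem sum_overlap_left {U V : Matrix ι ι ℂ} (hU : U ∈ unitaryGroup ι ℂ)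
    (hV : V ∈ unitaryGroup ι ℂ) (j : ι) : ∑ i, overlap U V i j = 1 := by
  simp_rw [overlap_comm U V]
  exact sum_overlap_right hV hU j

theorem sum_overlap_mul_left {U V : Matrix ι ι ℂ} (hU : U ∈ unitaryGroup ι ℂ)
    (hV : V ∈ unitaryGroup ι ℂ) (f : ι → ℝ) :
    ∑ i, ∑ j, overlap U V i j * f i = ∑ i, f i := by
  simp_rw [← Finset.sum_mul, sum_overlap_right hU hV, one_mul]

theorem sum_overlap_mul_right {U V : Matrix ι ι ℂ} (hU : U ∈ unitaryGroup ι ℂ)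
    (hV : V ∈ unitaryGroup ι ℂ) (f : ι → ℝ) :
    ∑ i, ∑ j, overlap U V i j * f j = ∑ j, f j := by
  rw [Finset.sum_comm]
  simp_rw [← Finset.sum_mul, sum_overlap_left hU hV, one_mul]

theorem trace_ofSpectrum {U : Matrix ι ι ℂ} (hU : U ∈ unitaryGroup ι ℂ) (a : ι → ℝ) :
    (trace (ofSpectrum U a)).re = ∑ i, a i := by
  have hU' : Uᴴ * U = 1 := mem_unitaryGroup_iff'.1 hU
  rw [ofSpectrum, trace_mul_comm, ← Matrix.mul_assoc, hU', Matrix.one_mul, trace_diagonal]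
  simp

theorem trace_ofSpectrum_mul_ofSpectrum (U V : Matrix ι ι ℂ) (f g : ι → ℝ) :
    (trace (ofSpectrum U f * ofSpectrum V g)).re =
      ∑ i, ∑ j, overlap U V i j * (f i * g j) := by
  have h : trace (ofSpectrum U f * ofSpectrum V g) =
      trace (diagonal (fun i => (f i : ℂ)) * (Uᴴ * V) * (diagonal (fun i => (g i : ℂ)) *
        (Uᴴ * V)ᴴ)) := by
    simp only [ofSpectrum, conjTranspose_mul, conjTranspose_conjTranspose]
    rw [Matrix.mul_assoc U, Matrix.mul_assoc U, trace_mul_comm U]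
    simp only [Matrix.mul_assoc]
  rw [h, trace, Complex.re_sum]
  refine Finset.sum_congr rfl fun i _ => ?_
  rw [diag_apply, mul_apply, Complex.re_sum]
  refine Finset.sum_congr rfl fun j _ => ?_
  rw [diagonal_mul, diagonal_mul, conjTranspose_apply, overlap, Complex.normSq_apply]
  simp
  ring

theorem dualQuad_ofSpectrum {U V : Matrix ι ι ℂ} (hU : U ∈ unitaryGroup ι ℂ)
    (hV : V ∈ unitaryGroup ι ℂ) (a b : ι → ℝ) (Y : Matrix ι ι ℂ) (t : ℝ) :
    dualQuad (ofSpectrum U a) (ofSpectrum V b) (U * Y * Vᴴ) t =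
      ∑ i, ∑ j, (2 * ((a i - b j) * (star (Y i j) * (Uᴴ * V) i j).re) -
        (b j + t * a i) * Complex.normSq (Y i j)) := by
  have hU' : Uᴴ * U = 1 := mem_unitaryGroup_iff'.1 hU
  have hV' : Vᴴ * V = 1 := mem_unitaryGroup_iff'.1 hV
  set W := Uᴴ * V with hW
  set Da := diagonal (fun i => (a i : ℂ)) with hDa
  set Db := diagonal (fun i => (b i : ℂ)) with hDb
  have cU : ∀ M : Matrix ι ι ℂ, Uᴴ * (U * M) = M := fun M => by
    rw [← Matrix.mul_assoc, hU', Matrix.one_mul]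
  have cV : ∀ M : Matrix ι ι ℂ, Vᴴ * (V * M) = M := fun M => by
    rw [← Matrix.mul_assoc, hV', Matrix.one_mul]
  have t1 : trace ((U * Y * Vᴴ)ᴴ * (ofSpectrum U a - ofSpectrum V b)) =
      trace (Yᴴ * (Da * W - W * Db)) := by
    rw [conjTranspose_mul, conjTranspose_mul, conjTranspose_conjTranspose, Matrix.mul_assoc V,
      trace_mul_comm]
    simp only [ofSpectrum, Matrix.mul_sub, Matrix.sub_mul, Matrix.mul_assoc, cU, hV', hW,
      Matrix.mul_one]
    rfl
  have t2 : trace (U * Y * Vᴴ * ofSpectrum V b * (U * Y * Vᴴ)ᴴ) = trace (Y * Db * Yᴴ) := by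
    rw [conjTranspose_mul, conjTranspose_mul, conjTranspose_conjTranspose]
    simp only [ofSpectrum, Matrix.mul_assoc, cV]
    rw [trace_mul_comm]
    simp only [Matrix.mul_assoc, hU', Matrix.mul_one]
    rfl
  have t3 : trace ((U * Y * Vᴴ)ᴴ * ofSpectrum U a * (U * Y * Vᴴ)) = trace (Yᴴ * Da * Y) := by
    rw [conjTranspose_mul, conjTranspose_mul, conjTranspose_conjTranspose]
    simp only [ofSpectrum, Matrix.mul_assoc, cU]
    rw [trace_mul_comm]
    simp only [Matrix.mul_assoc, hV', Matrix.mul_one]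
    rfl
  have s1 : (trace (Yᴴ * (Da * W - W * Db))).re =
      ∑ i, ∑ j, (a i - b j) * (star (Y i j) * W i j).re := by
    rw [trace, Complex.re_sum, Finset.sum_comm]
    refine Finset.sum_congr rfl fun j _ => ?_
    rw [diag_apply, mul_apply, Complex.re_sum]
    refine Finset.sum_congr rfl fun i _ => ?_
    rw [Matrix.sub_apply, hDa, hDb, diagonal_mul, mul_diagonal, conjTranspose_apply]
    simp
    ring
  have s2 : (trace (Y * Db * Yᴴ)).re = ∑ i, ∑ j, b j * Complex.normSq (Y i j) := by
    rw [trace, Complex.re_sum]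
    refine Finset.sum_congr rfl fun i _ => ?_
    rw [diag_apply, mul_apply, Complex.re_sum]
    refine Finset.sum_congr rfl fun j _ => ?_
    rw [hDb, mul_diagonal, conjTranspose_apply, Complex.normSq_apply]
    simp
    ring
  have s3 : (trace (Yᴴ * Da * Y)).re = ∑ i, ∑ j, a i * Complex.normSq (Y i j) := by
    rw [trace, Complex.re_sum, Finset.sum_comm]
    refine Finset.sum_congr rfl fun j _ => ?_
    rw [diag_apply, mul_apply, Complex.re_sum]
    refine Finset.sum_congr rfl fun i _ => ?_
    rw [hDa, mul_diagonal, conjTranspose_apply, Complex.normSq_apply]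
    simp
    ring
  rw [dualQuad, t1, t2, t3, s1, s2, s3]
  simp only [Finset.mul_sum, ← Finset.sum_sub_distrib]
  refine Finset.sum_congr rfl fun i _ => Finset.sum_congr rfl fun j _ => ?_
  ring

theorem dualQuad_le_specQuad {U V : Matrix ι ι ℂ} (hU : U ∈ unitaryGroup ι ℂ)
    (hV : V ∈ unitaryGroup ι ℂ) {a b : ι → ℝ} (ha : ∀ i, 0 ≤ a i) (hb : ∀ j, 0 ≤ b j)
    (X : Matrix ι ι ℂ) {t : ℝ} (ht : 0 < t) :
    dualQuad (ofSpectrum U a) (ofSpectrum V b) X t ≤ specQuad U a V b t := by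
  have hX : X = U * (Uᴴ * X * V) * Vᴴ := by
    have hU' : U * Uᴴ = 1 := mem_unitaryGroup_iff.1 hU
    have hV' : V * Vᴴ = 1 := mem_unitaryGroup_iff.1 hV
    simp only [Matrix.mul_assoc, hV', Matrix.mul_one]
    rw [← Matrix.mul_assoc, hU', Matrix.one_mul]
  rw [hX, dualQuad_ofSpectrum hU hV]
  refine Finset.sum_le_sum fun i _ => Finset.sum_le_sum fun j _ => ?_
  generalize (Uᴴ * X * V) i j = y
  rw [overlap]
  generalize (Uᴴ * V) i j = w
  have hc : 0 ≤ b j + t * a i := add_nonneg (hb j) (mul_nonneg ht.le (ha i))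
  rcases hc.eq_or_lt with hc | hc
  · have h1 : b j = 0 := by nlinarith [hb j, mul_nonneg ht.le (ha i)]
    have h2 : a i = 0 := by
      have : t * a i = 0 := by linarith
      exact (mul_eq_zero.1 this).resolve_left ht.ne'
    simp [h1, h2]
  · rw [← mul_div_assoc, le_div_iff₀ hc]
    simp only [Complex.star_def, Complex.mul_re, Complex.conj_re, Complex.conj_im,
      Complex.normSq_apply]
    nlinarith [sq_nonneg ((b j + t * a i) * y.re - (a i - b j) * w.re),
      sq_nonneg ((b j + t * a i) * y.im - (a i - b j) * w.im)]

theorem exists_dualQuad_eq_specQuad {U V : Matrix ι ι ℂ} (hU : U ∈ unitaryGroup ι ℂ)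
    (hV : V ∈ unitaryGroup ι ℂ) (a b : ι → ℝ) (t : ℝ) :
    ∃ X, dualQuad (ofSpectrum U a) (ofSpectrum V b) X t = specQuad U a V b t := by
  refine ⟨U * (of fun i j => (((a i - b j) / (b j + t * a i) : ℝ) : ℂ) * (Uᴴ * V) i j) * Vᴴ, ?_⟩
  rw [dualQuad_ofSpectrum hU hV]
  refine Finset.sum_congr rfl fun i _ => Finset.sum_congr rfl fun j _ => ?_
  rw [overlap, of_apply]
  generalize (Uᴴ * V) i j = w
  generalize a i - b j = d
  generalize b j + t * a i = c
  simp only [Complex.star_def, Complex.mul_re, Complex.conj_re, Complex.conj_im,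
    Complex.normSq_apply, Complex.mul_im, Complex.ofReal_re, Complex.ofReal_im]
  rcases eq_or_ne c 0 with rfl | hc
  · simp
  · field_simp
    ring

theorem specQuad_le_sum {U V : Matrix ι ι ℂ} {U' V' : κ → Matrix ι ι ℂ} {a b : ι → ℝ}
    {a' b' : κ → ι → ℝ} (hU : U ∈ unitaryGroup ι ℂ) (hV : V ∈ unitaryGroup ι ℂ)
    (hU' : ∀ x, U' x ∈ unitaryGroup ι ℂ) (hV' : ∀ x, V' x ∈ unitaryGroup ι ℂ)
    (ha' : ∀ x i, 0 ≤ a' x i) (hb' : ∀ x i, 0 ≤ b' x i)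
    (hA : ofSpectrum U a = ∑ x, ofSpectrum (U' x) (a' x))
    (hB : ofSpectrum V b = ∑ x, ofSpectrum (V' x) (b' x)) {t : ℝ} (ht : 0 < t) :
    specQuad U a V b t ≤ ∑ x, specQuad (U' x) (a' x) (V' x) (b' x) t := by
  obtain ⟨X, hX⟩ := exists_dualQuad_eq_specQuad hU hV a b t
  rw [← hX, hA, hB, dualQuad_sum]
  exact Finset.sum_le_sum fun x _ =>
    dualQuad_le_specQuad (hU' x) (hV' x) (ha' x) (hb' x) X ht

/-- An antiderivative of the weighted quadratic divergence. -/
noncomputable def specPrimitive (U : Matrix ι ι ℂ) (a : ι → ℝ) (V : Matrix ι ι ℂ) (b : ι → ℝ)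
    (t : ℝ) : ℝ :=
  ∑ i, ∑ j, overlap U V i j * relEntPrimitive (a i) (b j) t

omit [DecidableEq ι] in
theorem hasDerivAt_overlap_mul_relEntPrimitive {U V : Matrix ι ι ℂ} {a b : ι → ℝ}
    (ha : ∀ i, 0 ≤ a i) (hb : ∀ j, 0 ≤ b j)
    (hs : ∀ i j, b j = 0 → overlap U V i j * a i = 0) {t : ℝ} (ht : 0 ≤ t) (i j : ι) :
    HasDerivAt (fun t => overlap U V i j * relEntPrimitive (a i) (b j) t)
      (overlap U V i j * ((a i - b j) ^ 2 / (b j + t * a i)) / (1 + t) ^ 2) t := by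
  rcases (hb j).eq_or_lt with h | h
  · rcases mul_eq_zero.1 (hs i j h.symm) with h' | h'
    · simpa [h'] using hasDerivAt_const t (0 : ℝ)
    · have : (fun t => overlap U V i j * relEntPrimitive (a i) (b j) t) = fun _ => 0 := by
        funext t
        simp [relEntPrimitive, ← h, h']
      rw [this]
      simpa [← h, h'] using hasDerivAt_const t (0 : ℝ)
  · rw [mul_div_assoc]
    exact (hasDerivAt_relEntPrimitive ht
      (add_pos_of_pos_of_nonneg h (mul_nonneg ht (ha i)))).const_mul _

omit [DecidableEq ι] in
theorem hasDerivAt_specPrimitive {U V : Matrix ι ι ℂ} {a b : ι → ℝ} (ha : ∀ i, 0 ≤ a i)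
    (hb : ∀ j, 0 ≤ b j) (hs : ∀ i j, b j = 0 → overlap U V i j * a i = 0) {t : ℝ} (ht : 0 ≤ t) :
    HasDerivAt (specPrimitive U a V b) (specQuad U a V b t / (1 + t) ^ 2) t := by
  rw [specQuad]
  simp only [Finset.sum_div]
  exact HasDerivAt.fun_sum fun i _ => HasDerivAt.fun_sum fun j _ =>
    hasDerivAt_overlap_mul_relEntPrimitive ha hb hs ht i j

omit [DecidableEq ι] in
theorem tendsto_specPrimitive (U V : Matrix ι ι ℂ) {a : ι → ℝ} (b : ι → ℝ) (ha : ∀ i, 0 ≤ a i) :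
    Tendsto (specPrimitive U a V b) atTop
      (nhds (∑ i, ∑ j, overlap U V i j * (a i * Real.log (a i)))) :=
  tendsto_finsetSum _ fun i _ => tendsto_finsetSum _ fun _ _ =>
    (tendsto_relEntPrimitive (ha i)).const_mul _

theorem specPrimitive_zero {U V : Matrix ι ι ℂ} (hU : U ∈ unitaryGroup ι ℂ)
    (hV : V ∈ unitaryGroup ι ℂ) (a b : ι → ℝ) :
    specPrimitive U a V b 0 = ∑ i, ∑ j, overlap U V i j * (a i * Real.log (a i)) -
      specRelEnt U a V b + ∑ i, a i - ∑ j, b j := by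
  rw [← sum_overlap_mul_left hU hV a, ← sum_overlap_mul_right hU hV b, specPrimitive, specRelEnt]
  simp only [← Finset.sum_sub_distrib, ← Finset.sum_add_distrib, relEntPrimitive_zero]
  refine Finset.sum_congr rfl fun i _ => Finset.sum_congr rfl fun j _ => ?_
  ring

/-- Subadditivity of the relative entropy, in terms of spectral decompositions. -/
theorem specRelEnt_le_sum {U V : Matrix ι ι ℂ} {U' V' : κ → Matrix ι ι ℂ} {a b : ι → ℝ}
    {a' b' : κ → ι → ℝ} (hU : U ∈ unitaryGroup ι ℂ) (hV : V ∈ unitaryGroup ι ℂ)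
    (hU' : ∀ x, U' x ∈ unitaryGroup ι ℂ) (hV' : ∀ x, V' x ∈ unitaryGroup ι ℂ)
    (ha : ∀ i, 0 ≤ a i) (hb : ∀ i, 0 ≤ b i)
    (ha' : ∀ x i, 0 ≤ a' x i) (hb' : ∀ x i, 0 ≤ b' x i)
    (hs : ∀ i j, b j = 0 → overlap U V i j * a i = 0)
    (hs' : ∀ x i j, b' x j = 0 → overlap (U' x) (V' x) i j * a' x i = 0)
    (hA : ofSpectrum U a = ∑ x, ofSpectrum (U' x) (a' x))
    (hB : ofSpectrum V b = ∑ x, ofSpectrum (V' x) (b' x)) :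
    specRelEnt U a V b ≤ ∑ x, specRelEnt (U' x) (a' x) (V' x) (b' x) := by
  set G : ℝ → ℝ := fun t =>
    ∑ x, specPrimitive (U' x) (a' x) (V' x) (b' x) t - specPrimitive U a V b t with hG
  have hd : ∀ t, 0 ≤ t → HasDerivAt G (∑ x, specQuad (U' x) (a' x) (V' x) (b' x) t / (1 + t) ^ 2 -
      specQuad U a V b t / (1 + t) ^ 2) t := fun t ht =>
    (HasDerivAt.fun_sum fun x _ =>
      hasDerivAt_specPrimitive (ha' x) (hb' x) (hs' x) ht).sub (hasDerivAt_specPrimitive ha hb hs ht)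
  have hmono : MonotoneOn G (Set.Ici 0) := by
    refine monotoneOn_of_deriv_nonneg (convex_Ici 0)
      (fun t ht => (hd t ht).continuousAt.continuousWithinAt)
      (fun t ht => ?_) (fun t ht => ?_)
    · rw [interior_Ici] at ht
      exact (hd t (le_of_lt ht)).differentiableAt.differentiableWithinAt
    · rw [interior_Ici] at ht
      rw [(hd t (le_of_lt ht)).deriv, ← Finset.sum_div, ← sub_div]
      exact div_nonneg (sub_nonneg.2 (specQuad_le_sum hU hV hU' hV' ha' hb' hA hB ht))
        (sq_nonneg _)
  have hlim : Tendsto G atTop (nhds (∑ x, ∑ i, ∑ j, overlap (U' x) (V' x) i j *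
      (a' x i * Real.log (a' x i)) - ∑ i, ∑ j, overlap U V i j * (a i * Real.log (a i)))) :=
    (tendsto_finsetSum _ fun x _ => tendsto_specPrimitive _ _ _ (ha' x)).sub
      (tendsto_specPrimitive _ _ _ ha)
  have hle := ge_of_tendsto hlim (b := G 0) (by
    filter_upwards [eventually_ge_atTop 0] with t ht
    exact hmono (Set.mem_Ici.2 le_rfl) ht ht)
  have trA : ∑ i, a i = ∑ x, ∑ i, a' x i := by
    rw [← trace_ofSpectrum hU, hA, trace_sum, Complex.re_sum]
    exact Finset.sum_congr rfl fun x _ => trace_ofSpectrum (hU' x) _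
  have trB : ∑ i, b i = ∑ x, ∑ i, b' x i := by
    rw [← trace_ofSpectrum hV, hB, trace_sum, Complex.re_sum]
    exact Finset.sum_congr rfl fun x _ => trace_ofSpectrum (hV' x) _
  simp only [hG, specPrimitive_zero hU hV, specPrimitive_zero (hU' _) (hV' _), trA, trB,
    Finset.sum_sub_distrib, Finset.sum_add_distrib] at hle
  linarith

theorem specRelEnt_smul {U V : Matrix ι ι ℂ} (hU : U ∈ unitaryGroup ι ℂ)
    (hV : V ∈ unitaryGroup ι ℂ) {a b : ι → ℝ} (hs : ∀ i j, b j = 0 → overlap U V i j * a i = 0)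
    {c d : ℝ} (hc : c ≠ 0) (hd : d ≠ 0) :
    specRelEnt U (fun i => c * a i) V (fun j => d * b j) =
      c * specRelEnt U a V b + c * (Real.log c - Real.log d) * ∑ i, a i := by
  rw [← sum_overlap_mul_left hU hV a, specRelEnt, specRelEnt]
  simp only [Finset.mul_sum, ← Finset.sum_add_distrib]
  refine Finset.sum_congr rfl fun i _ => Finset.sum_congr rfl fun j _ => ?_
  rcases eq_or_ne (a i) 0 with h | h
  · simp [h]
  rcases eq_or_ne (b j) 0 with h' | h'
  · have : overlap U V i j = 0 := (mul_eq_zero.1 (hs i j h')).resolve_right h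
    simp [this]
  rw [Real.log_mul hc h, Real.log_mul hd h']
  ring

theorem ofSpectrum_smul (U : Matrix ι ι ℂ) (a : ι → ℝ) (c : ℝ) :
    ofSpectrum U (fun i => c * a i) = (c : ℂ) • ofSpectrum U a := by
  have h : (diagonal fun i => ((c * a i : ℝ) : ℂ)) = (c : ℂ) • diagonal fun i => (a i : ℂ) := by
    rw [← diagonal_smul]
    congr 1
    funext i
    simp
  rw [ofSpectrum, ofSpectrum, h, Matrix.mul_smul, Matrix.smul_mul]

theorem overlap_mul_eq_zero_of_ker_le {U V : Matrix ι ι ℂ} (hU : U ∈ unitaryGroup ι ℂ)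
    (hV : V ∈ unitaryGroup ι ℂ) {a b : ι → ℝ}
    (h : ∀ v, ofSpectrum V b *ᵥ v = 0 → ofSpectrum U a *ᵥ v = 0) (i j : ι) (hj : b j = 0) :
    overlap U V i j * a i = 0 := by
  have hU' : Uᴴ * U = 1 := mem_unitaryGroup_iff'.1 hU
  have hV' : Vᴴ * V = 1 := mem_unitaryGroup_iff'.1 hV
  have h1 : ofSpectrum V b *ᵥ (V *ᵥ Pi.single j 1) = 0 := by
    rw [mulVec_mulVec, ofSpectrum, Matrix.mul_assoc, hV', Matrix.mul_one, ← mulVec_mulVec,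
      diagonal_mulVec_single, hj]
    simp
  have h2 : (Uᴴ * (ofSpectrum U a * V)) *ᵥ Pi.single j 1 = 0 := by
    rw [← mulVec_mulVec, ← mulVec_mulVec, h _ h1, mulVec_zero]
  have h3 : Uᴴ * (ofSpectrum U a * V) = diagonal (fun i => (a i : ℂ)) * (Uᴴ * V) := by
    rw [ofSpectrum, ← Matrix.mul_assoc, ← Matrix.mul_assoc, ← Matrix.mul_assoc, hU',
      Matrix.one_mul, Matrix.mul_assoc]
  rw [h3, mulVec_single_one] at h2
  have h4 := congrFun h2 i
  rw [col_apply, diagonal_mul, Pi.zero_apply, mul_eq_zero, Complex.ofReal_eq_zero] at h4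
  rcases h4 with h4 | h4 <;> simp [overlap, h4]

omit [DecidableEq ι] in
theorem mulVec_eq_zero_of_sum_mulVec_eq_zero {A : κ → Matrix ι ι ℂ} (hA : ∀ x, (A x).PosSemidef)
    {v : ι → ℂ} (h : (∑ x, A x) *ᵥ v = 0) (x : κ) : A x *ᵥ v = 0 := by
  have h1 : ∑ x, star v ⬝ᵥ (A x *ᵥ v) = 0 := by
    rw [← dotProduct_sum, ← sum_mulVec, h, dotProduct_zero]
  have h2 := (Finset.sum_eq_zero_iff_of_nonneg
    fun x _ => (hA x).dotProduct_mulVec_nonneg v).1 h1 x (Finset.mem_univ x)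
  exact ((hA x).dotProduct_mulVec_zero_iff v).1 h2

end Spectral

section MatrixLog

variable {k : ℕ}

theorem Matrix.IsHermitian.eq_ofSpectrum {A : Matrix (Fin k) (Fin k) ℂ} (hA : A.IsHermitian) :
    A = ofSpectrum (hA.eigenvectorUnitary : Matrix (Fin k) (Fin k) ℂ) hA.eigenvalues := by
  conv_lhs => rw [hA.spectral_theorem]
  rfl

theorem mlog_eq_ofSpectrum {A : Matrix (Fin k) (Fin k) ℂ} (hA : A.IsHermitian) :
    mlog A = ofSpectrum (hA.eigenvectorUnitary : Matrix (Fin k) (Fin k) ℂ)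
      (fun i => Real.log (hA.eigenvalues i)) := by
  rw [mlog, dif_pos hA]
  rfl

theorem qRelEnt_eq_specRelEnt {A B : Matrix (Fin k) (Fin k) ℂ} (hA : A.IsHermitian)
    (hB : B.IsHermitian) :
    qRelEnt A B = specRelEnt (hA.eigenvectorUnitary : Matrix (Fin k) (Fin k) ℂ) hA.eigenvalues
      (hB.eigenvectorUnitary : Matrix (Fin k) (Fin k) ℂ) hB.eigenvalues := by
  set U := (hA.eigenvectorUnitary : Matrix (Fin k) (Fin k) ℂ) with hU
  have hUm : U ∈ unitaryGroup (Fin k) ℂ := hA.eigenvectorUnitary.2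
  have hU' : Uᴴ * U = 1 := mem_unitaryGroup_iff'.1 hUm
  have e : A * (mlog A - mlog B) =
      ofSpectrum U hA.eigenvalues * ofSpectrum U (fun i => Real.log (hA.eigenvalues i)) -
      ofSpectrum U hA.eigenvalues * ofSpectrum (hB.eigenvectorUnitary : Matrix (Fin k) (Fin k) ℂ)
        (fun i => Real.log (hB.eigenvalues i)) := by
    rw [← Matrix.mul_sub, ← mlog_eq_ofSpectrum, ← mlog_eq_ofSpectrum, ← hA.eq_ofSpectrum]
  have d : ∑ i, ∑ j, overlap U U i j * (hA.eigenvalues i * Real.log (hA.eigenvalues j)) =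
      ∑ i, hA.eigenvalues i * Real.log (hA.eigenvalues i) := by
    refine Finset.sum_congr rfl fun i _ => ?_
    rw [Finset.sum_eq_single i]
    · simp [overlap, hU']
    · intro j _ hj
      simp [overlap, hU', one_apply_ne hj.symm]
    · simp
  rw [qRelEnt, e, trace_sub, Complex.sub_re, trace_ofSpectrum_mul_ofSpectrum,
    trace_ofSpectrum_mul_ofSpectrum, d,
    ← sum_overlap_mul_left hUm hB.eigenvectorUnitary.2
      (fun i => hA.eigenvalues i * Real.log (hA.eigenvalues i)), specRelEnt]
  simp only [← Finset.sum_sub_distrib]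
  refine Finset.sum_congr rfl fun i _ => Finset.sum_congr rfl fun j _ => ?_
  ring

end MatrixLog

/-- Lemma 4 / monotonicity of relative entropy form:
`D(p‖q) + Σ_x p_x D(ρ_x‖σ_x) ≥ D(ρ‖σ)` with `ρ = Σ_x p_x ρ_x`, `σ = Σ_x q_x σ_x`,
with equality when `q = p` and `σ_x = ρ_x` on the support of `p`. -/
theorem stmt_0 {n m : ℕ} (p q : Fin n → ℝ) (hp : IsDist p) (hq : IsDist q)
    (hpq : ∀ x, q x = 0 → p x = 0)
    (ρ σ : Fin n → Matrix (Fin m) (Fin m) ℂ)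
    (hρ : ∀ x, IsDensity (ρ x)) (hσ : ∀ x, IsDensity (σ x))
    (hsupp : ∀ x, 0 < p x → SuppLE (ρ x) (σ x)) :
    qRelEnt (∑ x, (p x : ℂ) • ρ x) (∑ x, (q x : ℂ) • σ x) ≤
      cRelEnt p q + ∑ x, p x * qRelEnt (ρ x) (σ x) ∧
    ((q = p ∧ ∀ x, 0 < p x → σ x = ρ x) →
      qRelEnt (∑ x, (p x : ℂ) • ρ x) (∑ x, (q x : ℂ) • σ x) =
        cRelEnt p q + ∑ x, p x * qRelEnt (ρ x) (σ x)) := by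
  have hp0 := hp.1
  have hq0 := hq.1
  have pA : ∀ x, ((p x : ℂ) • ρ x).PosSemidef := fun x =>
    (hρ x).1.smul (by exact_mod_cast hp0 x)
  have pB : ∀ x, ((q x : ℂ) • σ x).PosSemidef := fun x =>
    (hσ x).1.smul (by exact_mod_cast hq0 x)
  have hA : (∑ x, (p x : ℂ) • ρ x).PosSemidef := posSemidef_sum _ fun x _ => pA x
  have hB : (∑ x, (q x : ℂ) • σ x).PosSemidef := posSemidef_sum _ fun x _ => pB x
  have hker : ∀ x, SuppLE ((p x : ℂ) • ρ x) ((q x : ℂ) • σ x) := by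
    intro x v hv
    rcases (hp0 x).eq_or_lt with h | h
    · simp [← h]
    · have hqx : (q x : ℂ) ≠ 0 := by
        exact_mod_cast fun h' => h.ne' (hpq x h')
      rw [smul_mulVec, smul_eq_zero] at hv
      rw [smul_mulVec, hsupp x h v (hv.resolve_left hqx), smul_zero]
  refine ⟨?_, ?_⟩
  · set U := fun x => ((hρ x).1.isHermitian.eigenvectorUnitary : Matrix (Fin m) (Fin m) ℂ)
    set V := fun x => ((hσ x).1.isHermitian.eigenvectorUnitary : Matrix (Fin m) (Fin m) ℂ)
    have hU : ∀ x, U x ∈ unitaryGroup (Fin m) ℂ := fun x =>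
      (hρ x).1.isHermitian.eigenvectorUnitary.2
    have hV : ∀ x, V x ∈ unitaryGroup (Fin m) ℂ := fun x =>
      (hσ x).1.isHermitian.eigenvectorUnitary.2
    set a := fun x => (hρ x).1.isHermitian.eigenvalues
    set b := fun x => (hσ x).1.isHermitian.eigenvalues
    have eA : ∀ x, ofSpectrum (U x) (fun i => p x * a x i) = (p x : ℂ) • ρ x := fun x => by
      rw [ofSpectrum_smul, ← (hρ x).1.isHermitian.eq_ofSpectrum]
    have eB : ∀ x, ofSpectrum (V x) (fun i => q x * b x i) = (q x : ℂ) • σ x := fun x => by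
      rw [ofSpectrum_smul, ← (hσ x).1.isHermitian.eq_ofSpectrum]
    have key : qRelEnt (∑ x, (p x : ℂ) • ρ x) (∑ x, (q x : ℂ) • σ x) ≤
        ∑ x, specRelEnt (U x) (fun i => p x * a x i) (V x) (fun i => q x * b x i) := by
      rw [qRelEnt_eq_specRelEnt hA.isHermitian hB.isHermitian]
      refine specRelEnt_le_sum hA.isHermitian.eigenvectorUnitary.2
        hB.isHermitian.eigenvectorUnitary.2 hU hV hA.eigenvalues_nonneg hB.eigenvalues_nonneg
        (fun x i => mul_nonneg (hp0 x) ((hρ x).1.eigenvalues_nonneg i))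
        (fun x i => mul_nonneg (hq0 x) ((hσ x).1.eigenvalues_nonneg i)) ?_ ?_ ?_ ?_
      · refine overlap_mul_eq_zero_of_ker_le hA.isHermitian.eigenvectorUnitary.2
          hB.isHermitian.eigenvectorUnitary.2 fun v hv => ?_
        rw [← hB.isHermitian.eq_ofSpectrum] at hv
        rw [← hA.isHermitian.eq_ofSpectrum, sum_mulVec]
        exact Finset.sum_eq_zero fun x _ =>
          hker x v (mulVec_eq_zero_of_sum_mulVec_eq_zero pB hv x)
      · intro x
        refine overlap_mul_eq_zero_of_ker_le (hU x) (hV x) ?_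
        rw [eA, eB]
        exact hker x
      · rw [← hA.isHermitian.eq_ofSpectrum]
        exact Finset.sum_congr rfl fun x _ => (eA x).symm
      · rw [← hB.isHermitian.eq_ofSpectrum]
        exact Finset.sum_congr rfl fun x _ => (eB x).symm
    refine key.trans_eq ?_
    rw [cRelEnt, ← Finset.sum_add_distrib]
    refine Finset.sum_congr rfl fun x _ => ?_
    rcases (hp0 x).eq_or_lt with h | h
    · simp [← h, specRelEnt]
    · have hs : ∀ i j, b x j = 0 → overlap (U x) (V x) i j * a x i = 0 := by
        refine overlap_mul_eq_zero_of_ker_le (hU x) (hV x) ?_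
        rw [← (hρ x).1.isHermitian.eq_ofSpectrum, ← (hσ x).1.isHermitian.eq_ofSpectrum]
        exact hsupp x h
      have htr : ∑ i, a x i = 1 := by
        rw [← trace_ofSpectrum (hU x), ← (hρ x).1.isHermitian.eq_ofSpectrum, (hρ x).2,
          Complex.one_re]
      rw [specRelEnt_smul (hU x) (hV x) hs h.ne' fun h' => h.ne' (hpq x h'), htr,
        qRelEnt_eq_specRelEnt (hρ x).1.isHermitian (hσ x).1.isHermitian]
      ring
  · rintro ⟨rfl, hx⟩
    have e : ∀ x, (q x : ℂ) • σ x = (q x : ℂ) • ρ x := fun x => by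
      rcases (hq0 x).eq_or_lt with h | h
      · simp [← h]
      · rw [hx x h]
    have z : ∀ x, q x * qRelEnt (ρ x) (σ x) = 0 := fun x => by
      rcases (hq0 x).eq_or_lt with h | h
      · simp [← h]
      · simp [hx x h, qRelEnt]
    rw [Finset.sum_congr rfl fun x _ => e x, Finset.sum_congr rfl fun x _ => z x]
    simp [qRelEnt, cRelEnt]
end

section
/- Fix λ ≥ 0, a cost vector s ∈ ℝ^n with s ≥ 0, and a classical-quantum channel (ρ_x)_{x∈X}. For any fixed probability distribution p on X with p_x > 0 for all x, the function p' ↦ f_λ(p, p') over strictly positive probability distributions p' attains its maximum at p' = p; that is, f_λ(p, p') ≤ f_λ(p, p) for all strictly positive distributions p'. -/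
open Matrix Finset Filter ComplexOrder

/-- If `∑ c = 0` and `∑ c / (u + t) ≤ 0` for every `u > 0`, then `∑ c * log t ≥ 0`. -/
lemma sum_mul_log_nonneg {ι : Type*} [Fintype ι] (c t : ι → ℝ) (hc : ∑ i, c i = 0)
    (ht : ∀ i, c i ≠ 0 → 0 < t i) (h : ∀ u : ℝ, 0 < u → ∑ i, c i / (u + t i) ≤ 0) :
    0 ≤ ∑ i, c i * Real.log (t i) := by
  have hderiv : ∀ u : ℝ, 0 ≤ u → HasDerivAt (fun u => ∑ i, c i * Real.log (u + t i))
      (∑ i, c i / (u + t i)) u := by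
    intro u hu
    refine HasDerivAt.fun_sum fun i _ => ?_
    by_cases hci : c i = 0
    · simpa [hci] using hasDerivAt_const u (0 : ℝ)
    · have hpos : u + t i ≠ 0 := by linarith [ht i hci]
      simpa [div_eq_mul_inv] using (((hasDerivAt_id u).add_const (t i)).log hpos).const_mul (c i)
  have hanti : AntitoneOn (fun u => ∑ i, c i * Real.log (u + t i)) (Set.Ici 0) := by
    refine antitoneOn_of_deriv_nonpos (convex_Ici 0)
      (fun u hu => (hderiv u hu).continuousAt.continuousWithinAt) ?_ ?_
    · rw [interior_Ici]
      exact fun u hu => (hderiv u (le_of_lt hu)).differentiableAt.differentiableWithinAt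
    · rw [interior_Ici]
      intro u hu
      rw [(hderiv u (le_of_lt hu)).deriv]
      exact h u hu
  have hlim : Tendsto (fun u : ℝ => ∑ i, c i * Real.log (1 + t i / u)) atTop (nhds 0) := by
    have hi : ∀ i, Tendsto (fun u : ℝ => c i * Real.log (1 + t i / u)) atTop (nhds 0) := by
      intro i
      have h1 : Tendsto (fun u : ℝ => 1 + t i / u) atTop (nhds 1) := by
        simpa using (tendsto_const_nhds (x := (1 : ℝ))).add (tendsto_id.const_div_atTop (t i))
      simpa using (h1.log one_ne_zero).const_mul (c i)
    simpa using tendsto_finsetSum Finset.univ fun i _ => hi i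
  refine le_of_tendsto hlim ?_
  filter_upwards [eventually_gt_atTop (0 : ℝ)] with u hu
  have heq : ∑ i, c i * Real.log (1 + t i / u) = ∑ i, c i * Real.log (u + t i) := by
    have h1 : ∀ i, c i * Real.log (1 + t i / u) =
        c i * Real.log (u + t i) - c i * Real.log u := by
      intro i
      by_cases hci : c i = 0
      · simp [hci]
      · have hpos : u + t i ≠ 0 := by linarith [ht i hci]
        rw [← mul_sub, ← Real.log_div hpos hu.ne']
        congr 2
        field_simp
    rw [Finset.sum_congr rfl fun i _ => h1 i, Finset.sum_sub_distrib, ← Finset.sum_mul, hc]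
    simp
  rw [heq]
  simpa using hanti (Set.mem_Ici.2 le_rfl) (Set.mem_Ici.2 hu.le) hu.le

section

variable {m : ℕ}

lemma mlog_eq_cfc {A : Matrix (Fin m) (Fin m) ℂ} (hA : A.IsHermitian) :
    mlog A = cfc Real.log A := by
  rw [hA.cfc_eq, mlog, dif_pos hA]
  rfl

/-- The trace of `A` against a function of `B`, in the eigenbasis of `B`. -/
lemma re_trace_mul_cfc (A : Matrix (Fin m) (Fin m) ℂ) {B : Matrix (Fin m) (Fin m) ℂ}
    (hB : B.IsHermitian) (f : ℝ → ℝ) :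
    (A * cfc f B).trace.re = ∑ i, f (hB.eigenvalues i) *
      (((hB.eigenvectorUnitary : Matrix (Fin m) (Fin m) ℂ)ᴴ * A *
        (hB.eigenvectorUnitary : Matrix (Fin m) (Fin m) ℂ)) i i).re := by
  rw [hB.cfc_eq, Matrix.IsHermitian.cfc, Unitary.conjStarAlgAut_apply, ← mul_assoc,
    Matrix.trace_mul_comm, star_eq_conjTranspose, ← mul_assoc, ← mul_assoc,
    Matrix.trace]
  simp [Matrix.mul_diagonal, mul_comm]

lemma conjTranspose_eigenvectorUnitary_mul_mul_apply (A : Matrix (Fin m) (Fin m) ℂ)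
    {B : Matrix (Fin m) (Fin m) ℂ} (hB : B.IsHermitian) (i : Fin m) :
    ((hB.eigenvectorUnitary : Matrix (Fin m) (Fin m) ℂ)ᴴ * A *
        (hB.eigenvectorUnitary : Matrix (Fin m) (Fin m) ℂ)) i i =
      star ⇑(hB.eigenvectorBasis i) ⬝ᵥ (A *ᵥ ⇑(hB.eigenvectorBasis i)) := by
  rw [mul_assoc, Matrix.mul_apply]
  rfl

lemma apply_eq_zero_of_eigenvalues_eq_zero {A B : Matrix (Fin m) (Fin m) ℂ}
    (hB : B.IsHermitian) (hAB : SuppLE A B) {i : Fin m} (hi : hB.eigenvalues i = 0) :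
    ((hB.eigenvectorUnitary : Matrix (Fin m) (Fin m) ℂ)ᴴ * A *
        (hB.eigenvectorUnitary : Matrix (Fin m) (Fin m) ℂ)) i i = 0 := by
  rw [conjTranspose_eigenvectorUnitary_mul_mul_apply, hAB _ (by simp [hB.mulVec_eigenvectorBasis, hi]),
    dotProduct_zero]

lemma isHermitian_ofReal_smul {A : Matrix (Fin m) (Fin m) ℂ} (hA : A.IsHermitian) (c : ℝ) :
    ((c : ℂ) • A).IsHermitian := by
  simp [Matrix.IsHermitian, Matrix.conjTranspose_smul, hA.eq]

lemma re_trace_mul_mlog_smul {A B : Matrix (Fin m) (Fin m) ℂ} (hB : B.IsHermitian)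
    (hAB : SuppLE A B) {c : ℝ} (hc : 0 < c) :
    (A * mlog ((c : ℂ) • B)).trace.re = (A * mlog B).trace.re + Real.log c * A.trace.re := by
  have htr : A.trace.re = ∑ i, (((hB.eigenvectorUnitary : Matrix (Fin m) (Fin m) ℂ)ᴴ * A *
        (hB.eigenvectorUnitary : Matrix (Fin m) (Fin m) ℂ)) i i).re := by
    have := re_trace_mul_cfc A hB (fun _ => 1)
    rw [cfc_const_one ℝ B hB.isSelfAdjoint] at this
    simpa using this
  rw [mlog_eq_cfc (isHermitian_ofReal_smul hB c), mlog_eq_cfc hB,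
    show (c : ℂ) • B = c • B from by ext; simp,
    ← cfc_comp_const_mul c Real.log B ((B.finite_real_spectrum.image _).continuousOn _)
      hB.isSelfAdjoint,
    re_trace_mul_cfc A hB, re_trace_mul_cfc A hB, htr, Finset.mul_sum, ← Finset.sum_add_distrib]
  refine Finset.sum_congr rfl fun i _ => ?_
  by_cases hi : hB.eigenvalues i = 0
  · simp [apply_eq_zero_of_eigenvalues_eq_zero hB hAB hi]
  · rw [Real.log_mul hc.ne' hi]
    ring

/-- Completing the square against a state `ρ`. -/
lemma IsDensity.two_mul_re_trace_sub_sq_le {ρ : Matrix (Fin m) (Fin m) ℂ} (hρ : IsDensity ρ)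
    (X : Matrix (Fin m) (Fin m) ℂ) (t : ℝ) :
    2 * t * (Xᴴ * ρ).trace.re - t ^ 2 ≤ (Xᴴ * ρ * X).trace.re := by
  have h := (hρ.1.conjTranspose_mul_mul_same (X - (t : ℂ) • 1)).trace_nonneg
  have hconj : (ρ * X).trace.re = (Xᴴ * ρ).trace.re := by
    rw [← Complex.conj_re, ← Complex.star_def, ← Matrix.trace_conjTranspose,
      Matrix.conjTranspose_mul, hρ.1.isHermitian.eq]
  have hexp : ((X - (t : ℂ) • 1)ᴴ * ρ * (X - (t : ℂ) • 1)).trace =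
      (Xᴴ * ρ * X).trace - t * (Xᴴ * ρ).trace - t * (ρ * X).trace + t * t * ρ.trace := by
    simp [Matrix.conjTranspose_sub, Matrix.conjTranspose_smul, sub_mul, mul_sub, Matrix.trace_sub,
      Matrix.trace_smul]
    ring
  rw [hexp, hρ.2] at h
  have h' := (Complex.le_def.1 h).1
  simp [hconj] at h'
  nlinarith

lemma IsDensity.two_mul_re_trace_sub_le {ρ : Matrix (Fin m) (Fin m) ℂ} (hρ : IsDensity ρ)
    (X : Matrix (Fin m) (Fin m) ℂ) {u p q : ℝ} (hu : 0 < u) (hp : 0 < p) (hq : 0 < q) :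
    p * (2 * (Xᴴ * ρ).trace.re - u * (X * ρ * Xᴴ).trace.re) - q * (Xᴴ * ρ * X).trace.re ≤
      p / (u + q / p) := by
  set t : ℝ := p / (u * p + q) with ht
  have h1 := hρ.two_mul_re_trace_sub_sq_le X t
  have h2 := hρ.two_mul_re_trace_sub_sq_le Xᴴ t
  have hconj : (X * ρ).trace.re = (Xᴴ * ρ).trace.re := by
    rw [← Complex.conj_re, ← Complex.star_def, ← Matrix.trace_conjTranspose,
      Matrix.conjTranspose_mul, hρ.1.isHermitian.eq, Matrix.trace_mul_comm]
  rw [Matrix.conjTranspose_conjTranspose, hconj] at h2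
  have hpos : 0 < u * p + q := by positivity
  have htp : (u * p + q) * t = p := by rw [ht]; field_simp
  have hval : p / (u + q / p) = p * t := by
    rw [ht]; field_simp
  have e1 := mul_le_mul_of_nonneg_left h1 hq.le
  have e2 := mul_le_mul_of_nonneg_left h2 (mul_pos hu hp).le
  have e3 : (u * p + q) * t * (2 * (Xᴴ * ρ).trace.re) - (u * p + q) * t * t =
      p * (2 * (Xᴴ * ρ).trace.re) - p * t := by rw [htp]
  rw [hval]
  nlinarith

/-- The trace functional `X ↦ 2 Re Tr(X*R) - u Tr(XRX*) - Tr(X*SX)` in eigenbases of `R` and `S`. -/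
lemma re_trace_conj_diagonal {U V : Matrix (Fin m) (Fin m) ℂ} (hU : Uᴴ * U = 1) (hV : Vᴴ * V = 1)
    (r s : Fin m → ℝ) (k : Fin m → Fin m → ℝ) :
    let M : Matrix (Fin m) (Fin m) ℂ := Matrix.of fun j i => (k i j : ℂ) * (Vᴴ * U) j i
    let X := V * M * Uᴴ
    let R := U * Matrix.diagonal (fun i => (r i : ℂ)) * Uᴴ
    let S := V * Matrix.diagonal (fun i => (s i : ℂ)) * Vᴴ
    (Xᴴ * R).trace.re = ∑ i, ∑ j, Complex.normSq ((Vᴴ * U) j i) * (k i j * r i) ∧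
    (X * R * Xᴴ).trace.re = ∑ i, ∑ j, Complex.normSq ((Vᴴ * U) j i) * (k i j ^ 2 * r i) ∧
    (Xᴴ * S * X).trace.re = ∑ i, ∑ j, Complex.normSq ((Vᴴ * U) j i) * (k i j ^ 2 * s j) := by
  intro M X R S
  have hU' (A : Matrix (Fin m) (Fin m) ℂ) : Uᴴ * (U * A) = A := by rw [← mul_assoc, hU, one_mul]
  have hV' (A : Matrix (Fin m) (Fin m) ℂ) : Vᴴ * (V * A) = A := by rw [← mul_assoc, hV, one_mul]
  have h1 : (Xᴴ * R).trace = (Mᴴ * (Vᴴ * U) * Matrix.diagonal (fun i => (r i : ℂ))).trace := by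
    have : Xᴴ * R = U * (Mᴴ * (Vᴴ * U) * Matrix.diagonal (fun i => (r i : ℂ)) * Uᴴ) := by
      simp [X, R, mul_assoc]
    rw [this, Matrix.trace_mul_comm, mul_assoc, hU, mul_one]
  have h2 : (X * R * Xᴴ).trace = (M * Matrix.diagonal (fun i => (r i : ℂ)) * Mᴴ).trace := by
    have : X * R * Xᴴ = V * (M * Matrix.diagonal (fun i => (r i : ℂ)) * Mᴴ * Vᴴ) := by
      simp [X, R, mul_assoc, hU']
    rw [this, Matrix.trace_mul_comm, mul_assoc, hV, mul_one]
  have h3 : (Xᴴ * S * X).trace = (Mᴴ * Matrix.diagonal (fun i => (s i : ℂ)) * M).trace := by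
    have : Xᴴ * S * X = U * (Mᴴ * Matrix.diagonal (fun i => (s i : ℂ)) * M * Uᴴ) := by
      simp [X, S, mul_assoc, hV']
    rw [this, Matrix.trace_mul_comm, mul_assoc, hU, mul_one]
  have hre : ∀ (z : ℂ) (a b : ℝ), (star ((a : ℂ) * z) * z * b).re = Complex.normSq z * (a * b) := by
    intro z a b
    simp [Complex.normSq_apply]
    ring
  have hre2 : ∀ (z : ℂ) (a b : ℝ),
      (star ((a : ℂ) * z) * b * ((a : ℂ) * z)).re = Complex.normSq z * (a ^ 2 * b) := by
    intro z a b
    simp [Complex.normSq_apply]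
    ring
  refine ⟨?_, ?_, ?_⟩
  · rw [h1, Matrix.trace, Complex.re_sum]
    refine Finset.sum_congr rfl fun i _ => ?_
    rw [Matrix.diag_apply, Matrix.mul_diagonal, Matrix.mul_apply, Finset.sum_mul, Complex.re_sum]
    exact Finset.sum_congr rfl fun j _ => hre _ _ _
  · rw [h2, Matrix.trace_mul_comm, ← mul_assoc, Matrix.trace, Complex.re_sum]
    refine Finset.sum_congr rfl fun i _ => ?_
    rw [Matrix.diag_apply, Matrix.mul_diagonal, Matrix.mul_apply, Finset.sum_mul, Complex.re_sum]
    refine Finset.sum_congr rfl fun j _ => ?_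
    rw [← hre2, mul_right_comm]
    rfl
  · rw [h3, Matrix.trace, Complex.re_sum]
    refine Finset.sum_congr rfl fun i _ => ?_
    rw [Matrix.diag_apply, Matrix.mul_apply, Complex.re_sum]
    refine Finset.sum_congr rfl fun j _ => ?_
    rw [Matrix.mul_diagonal]
    exact hre2 _ _ _

lemma posSemidef_ofReal_smul {A : Matrix (Fin m) (Fin m) ℂ} (hA : A.PosSemidef) {c : ℝ}
    (hc : 0 ≤ c) : ((c : ℂ) • A).PosSemidef :=
  hA.smul (Complex.zero_le_real.2 hc)

lemma suppLE_sum {n : ℕ} {ρ : Fin n → Matrix (Fin m) (Fin m) ℂ} (hρ : ∀ x, (ρ x).PosSemidef)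
    {p : Fin n → ℝ} (hp : ∀ x, 0 < p x) (x : Fin n) :
    SuppLE (ρ x) (∑ y, (p y : ℂ) • ρ y) := by
  intro v hv
  have h0 : ∑ y, (p y : ℂ) * (star v ⬝ᵥ (ρ y *ᵥ v)) = 0 := by
    have := congrArg (fun w => star v ⬝ᵥ w) hv
    simpa [Matrix.sum_mulVec, dotProduct_sum, Matrix.smul_mulVec] using this
  have hnn : ∀ y ∈ Finset.univ, 0 ≤ (p y : ℂ) * (star v ⬝ᵥ (ρ y *ᵥ v)) := fun y _ =>
    mul_nonneg (Complex.zero_le_real.2 (hp y).le) ((hρ y).dotProduct_mulVec_nonneg v)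
  have hx := (Finset.sum_eq_zero_iff_of_nonneg hnn).1 h0 x (Finset.mem_univ x)
  rcases mul_eq_zero.1 hx with h | h
  · exact absurd (Complex.ofReal_eq_zero.1 h) (hp x).ne'
  · exact ((hρ x).dotProduct_mulVec_zero_iff v).1 h

lemma SuppLE.sum {n : ℕ} {ρ : Fin n → Matrix (Fin m) (Fin m) ℂ} {σ : Matrix (Fin m) (Fin m) ℂ}
    (h : ∀ x, SuppLE (ρ x) σ) (p : Fin n → ℝ) : SuppLE (∑ y, (p y : ℂ) • ρ y) σ := by
  intro v hv
  simp [Matrix.sum_mulVec, Matrix.smul_mulVec, h _ v hv]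

/-- Data processing for the preparation channel `p ↦ ∑ x, p x • ρ x`. -/
lemma qRelEnt_sum_le_cRelEnt {n : ℕ} {ρ : Fin n → Matrix (Fin m) (Fin m) ℂ}
    (hρ : ∀ x, IsDensity (ρ x)) {p q : Fin n → ℝ} (hp : ∀ x, 0 < p x) (hq : ∀ x, 0 < q x)
    (hp1 : ∑ x, p x = 1) :
    qRelEnt (∑ x, (p x : ℂ) • ρ x) (∑ x, (q x : ℂ) • ρ x) ≤ cRelEnt p q := by
  set R := ∑ x, (p x : ℂ) • ρ x with hRdef
  set S := ∑ x, (q x : ℂ) • ρ x with hSdef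
  have hRpos : R.PosSemidef :=
    Matrix.posSemidef_sum _ fun x _ => posSemidef_ofReal_smul (hρ x).1 (hp x).le
  have hSpos : S.PosSemidef :=
    Matrix.posSemidef_sum _ fun x _ => posSemidef_ofReal_smul (hρ x).1 (hq x).le
  have hRtr : R.trace = 1 := by
    simp only [hRdef, Matrix.trace_sum, Matrix.trace_smul, (hρ _).2, smul_eq_mul, mul_one]
    exact_mod_cast hp1
  have hsupp : SuppLE R S := SuppLE.sum (fun x => suppLE_sum (fun x => (hρ x).1) hq x) p
  have hR := hRpos.isHermitian
  have hS := hSpos.isHermitian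
  set U : Matrix (Fin m) (Fin m) ℂ := ↑hR.eigenvectorUnitary with hUdef
  set V : Matrix (Fin m) (Fin m) ℂ := ↑hS.eigenvectorUnitary with hVdef
  set r := hR.eigenvalues
  set s := hS.eigenvalues
  have hr0 : ∀ i, 0 ≤ r i := hRpos.eigenvalues_nonneg
  have hs0 : ∀ i, 0 ≤ s i := hSpos.eigenvalues_nonneg
  have hUU : Uᴴ * U = 1 := Unitary.coe_star_mul_self hR.eigenvectorUnitary
  have hVV : Vᴴ * V = 1 := Unitary.coe_star_mul_self hS.eigenvectorUnitary
  have hVV' : V * Vᴴ = 1 := Unitary.coe_mul_star_self hS.eigenvectorUnitary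
  have hRspec : R = U * Matrix.diagonal (fun i => (r i : ℂ)) * Uᴴ := hR.spectral_theorem
  have hSspec : S = V * Matrix.diagonal (fun i => (s i : ℂ)) * Vᴴ := hS.spectral_theorem
  set w : Fin m → Fin m → ℝ := fun i j => Complex.normSq ((Vᴴ * U) j i) with hw
  have hw0 : ∀ i j, 0 ≤ w i j := fun i j => Complex.normSq_nonneg _
  have hw1 : ∀ i, ∑ j, w i j = 1 := by
    intro i
    have h : (Vᴴ * U)ᴴ * (Vᴴ * U) = 1 := by
      rw [Matrix.conjTranspose_mul, Matrix.conjTranspose_conjTranspose, mul_assoc,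
        ← mul_assoc V, hVV', one_mul, hUU]
    have h' := congrFun (congrFun h i) i
    rw [Matrix.mul_apply, Matrix.one_apply_eq] at h'
    have h'' := congrArg Complex.re h'
    rw [Complex.re_sum, Complex.one_re] at h''
    rw [← h'']
    refine Finset.sum_congr rfl fun j _ => ?_
    rw [Matrix.conjTranspose_apply, hw]
    simp [Complex.normSq_apply]
  have hdiagR : ∀ i, (Uᴴ * R * U) i i = r i := by
    intro i
    have : Uᴴ * R * U = Matrix.diagonal (fun i => (r i : ℂ)) := by
      rw [hRspec, mul_assoc, mul_assoc, hUU, mul_one, ← mul_assoc, hUU, one_mul]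
    rw [this, Matrix.diagonal_apply_eq]
  have hdiagS : ∀ j, ((Vᴴ * R * V) j j).re = ∑ i, r i * w i j := by
    intro j
    have : Vᴴ * R * V = (Vᴴ * U) * Matrix.diagonal (fun i => (r i : ℂ)) * (Vᴴ * U)ᴴ := by
      rw [hRspec]
      simp [mul_assoc]
    rw [this, Matrix.mul_apply, Complex.re_sum]
    refine Finset.sum_congr rfl fun i _ => ?_
    rw [Matrix.mul_diagonal, Matrix.conjTranspose_apply, hw]
    simp [Complex.normSq_apply]
    ring
  have hrsum : ∑ i, r i = 1 := by
    have h := congrArg Complex.re hRtr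
    rw [hRspec, Matrix.trace_mul_comm, ← mul_assoc, hUU, one_mul, Matrix.trace_diagonal,
      Complex.re_sum] at h
    simpa using h
  have hne : ∀ i j, r i * w i j ≠ 0 → 0 < r i ∧ 0 < s j := by
    intro i j hij
    refine ⟨lt_of_le_of_ne (hr0 i) fun h => hij (by simp [← h]),
      lt_of_le_of_ne (hs0 j) fun h => hij ?_⟩
    have hz := hdiagS j
    rw [apply_eq_zero_of_eigenvalues_eq_zero hS hsupp h.symm, Complex.zero_re] at hz
    exact (Finset.sum_eq_zero_iff_of_nonneg fun i _ => mul_nonneg (hr0 i) (hw0 i j)).1 hz.symm i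
      (Finset.mem_univ i)
  have hent : qRelEnt R S = ∑ i, ∑ j, r i * w i j * (Real.log (r i) - Real.log (s j)) := by
    rw [qRelEnt, mul_sub, Matrix.trace_sub, Complex.sub_re, mlog_eq_cfc hR, mlog_eq_cfc hS,
      re_trace_mul_cfc R hR, re_trace_mul_cfc R hS]
    simp only [mul_sub, Finset.sum_sub_distrib]
    congr 1
    · refine Finset.sum_congr rfl fun i _ => ?_
      rw [← Finset.sum_mul, ← Finset.mul_sum, hw1, ← hUdef, hdiagR, Complex.ofReal_re]
      ring
    · rw [Finset.sum_comm]
      refine Finset.sum_congr rfl fun j _ => ?_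
      rw [← hVdef, hdiagS, ← Finset.sum_mul, mul_comm]
  have hmain := sum_mul_log_nonneg (ι := (Fin m × Fin m) ⊕ Fin n)
    (Sum.elim (fun ij => r ij.1 * w ij.1 ij.2) fun x => -p x)
    (Sum.elim (fun ij => s ij.2 / r ij.1) fun x => q x / p x) ?_ ?_ ?_
  · rw [Fintype.sum_sum_type, Fintype.sum_prod_type] at hmain
    simp only [Sum.elim_inl, Sum.elim_inr] at hmain
    have e1 : ∑ i, ∑ j, r i * w i j * Real.log (s j / r i) = - qRelEnt R S := by
      rw [hent, ← Finset.sum_neg_distrib]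
      refine Finset.sum_congr rfl fun i _ => ?_
      rw [← Finset.sum_neg_distrib]
      refine Finset.sum_congr rfl fun j _ => ?_
      by_cases hij : r i * w i j = 0
      · simp [hij]
      · obtain ⟨h1, h2⟩ := hne i j hij
        rw [Real.log_div h2.ne' h1.ne']
        ring
    have e2 : ∑ x, -p x * Real.log (q x / p x) = cRelEnt p q := by
      refine Finset.sum_congr rfl fun x _ => ?_
      rw [Real.log_div (hq x).ne' (hp x).ne']
      ring
    rw [e1, e2] at hmain
    linarith
  · rw [Fintype.sum_sum_type, Fintype.sum_prod_type]
    simp only [Sum.elim_inl, Sum.elim_inr, ← Finset.mul_sum, hw1, mul_one, hrsum,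
      Finset.sum_neg_distrib, hp1]
    norm_num
  · rintro (⟨i, j⟩ | x) h
    · obtain ⟨h1, h2⟩ := hne i j h
      exact div_pos h2 h1
    · exact div_pos (hq x) (hp x)
  · intro u hu
    rw [Fintype.sum_sum_type, Fintype.sum_prod_type]
    simp only [Sum.elim_inl, Sum.elim_inr, neg_div, Finset.sum_neg_distrib]
    set k : Fin m → Fin m → ℝ := fun i j => r i / (u * r i + s j) with hk
    obtain ⟨t1, t2, t3⟩ := re_trace_conj_diagonal hUU hVV r s k
    rw [← hRspec] at t1 t2
    rw [← hSspec] at t3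
    set X := V * (Matrix.of fun j i => (k i j : ℂ) * (Vᴴ * U) j i) * Uᴴ
    have hlow : ∑ i, ∑ j, r i * w i j / (u + s j / r i) =
        2 * (Xᴴ * R).trace.re - u * (X * R * Xᴴ).trace.re - (Xᴴ * S * X).trace.re := by
      rw [t1, t2, t3]
      simp only [Finset.mul_sum, ← Finset.sum_sub_distrib]
      refine Finset.sum_congr rfl fun i _ => Finset.sum_congr rfl fun j _ => ?_
      rcases (hr0 i).eq_or_lt with h | h
      · simp [hk, ← h]
      · have hpos : 0 < u * r i + s j := by have := hs0 j; positivity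
        have e1 : r i * w i j / (u + s j / r i) = w i j * (k i j * r i) := by
          simp only [hk]
          field_simp
        have e2 : k i j * (u * r i + s j) = r i :=
          div_mul_cancel₀ _ hpos.ne'
        rw [e1]
        linear_combination (w i j * k i j) * e2
    have hsplit : 2 * (Xᴴ * R).trace.re - u * (X * R * Xᴴ).trace.re - (Xᴴ * S * X).trace.re =
        ∑ x, (p x * (2 * (Xᴴ * ρ x).trace.re - u * (X * ρ x * Xᴴ).trace.re) -
          q x * (Xᴴ * ρ x * X).trace.re) := by
      simp only [hRdef, hSdef, Matrix.sum_mul, Matrix.trace_sum, Complex.re_sum,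
        Matrix.mul_smul, Matrix.smul_mul, Matrix.trace_smul, smul_eq_mul, Complex.re_ofReal_mul,
        Finset.mul_sum, ← Finset.sum_sub_distrib]
      exact Finset.sum_congr rfl fun x _ => by ring
    rw [hlow, hsplit, ← sub_eq_add_neg, sub_nonpos]
    exact Finset.sum_le_sum fun x _ => (hρ x).two_mul_re_trace_sub_le X hu (hp x) (hq x)

/-- `fBA` as relative entropies plus a term depending on the first argument only. -/
lemma fBA_eq {n : ℕ} {ρ : Fin n → Matrix (Fin m) (Fin m) ℂ} (hρ : ∀ x, IsDensity (ρ x))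
    (s : Fin n → ℝ) (lam : ℝ) {p q : Fin n → ℝ} (hp : ∀ x, 0 < p x) (hq : ∀ x, 0 < q x) :
    fBA ρ s lam p q = qRelEnt (∑ x, (p x : ℂ) • ρ x) (∑ x, (q x : ℂ) • ρ x) - cRelEnt p q +
      (holevo ρ p - lam * ∑ x, s x * p x) := by
  have hS : (∑ y, (q y : ℂ) • ρ y).IsHermitian :=
    (Matrix.posSemidef_sum _ fun x _ =>
      posSemidef_ofReal_smul (hρ x).1 (hq x).le).isHermitian
  have hlin : ((∑ x, (p x : ℂ) • ρ x) * mlog (∑ y, (q y : ℂ) • ρ y)).trace.re =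
      ∑ x, p x * (ρ x * mlog (∑ y, (q y : ℂ) • ρ y)).trace.re := by
    simp [Matrix.sum_mul, Matrix.trace_sum, Matrix.trace_smul]
  have hterm : ∀ x, (Matrix.trace (((p x : ℂ) • ρ x) *
      (mlog ((q x : ℂ) • ρ x) - mlog ((p x : ℂ) • ∑ y, (q y : ℂ) • ρ y)))).re =
      -(p x * vN (ρ x)) - p x * (Real.log (p x) - Real.log (q x)) -
        p x * (ρ x * mlog (∑ y, (q y : ℂ) • ρ y)).trace.re := by
    intro x
    rw [Matrix.smul_mul, Matrix.trace_smul, smul_eq_mul, Complex.re_ofReal_mul, mul_sub,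
      Matrix.trace_sub, Complex.sub_re, re_trace_mul_mlog_smul (hρ x).1.isHermitian
        (fun _ h => h) (hq x), re_trace_mul_mlog_smul hS (suppLE_sum (fun y => (hρ y).1) hq x) (hp x),
      (hρ x).2, Complex.one_re, vN]
    ring
  rw [fBA, Finset.sum_congr rfl fun x _ => hterm x, qRelEnt, mul_sub, Matrix.trace_sub,
    Complex.sub_re, hlin, holevo, vN, cRelEnt]
  simp only [Finset.sum_sub_distrib, Finset.sum_neg_distrib]
  ring

end

/-- Lemma 3: for fixed strictly positive `p`, the map
`p' ↦ f_λ(p, p')` over strictly positive distributions is maximized at `p' = p`. -/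
theorem stmt_1 {n m : ℕ} (lam : ℝ) (hlam : 0 ≤ lam)
    (s : Fin n → ℝ) (hs : ∀ x, 0 ≤ s x)
    (ρ : Fin n → Matrix (Fin m) (Fin m) ℂ) (hρ : ∀ x, IsDensity (ρ x))
    (p : Fin n → ℝ) (hp : IsDist p) (hppos : ∀ x, 0 < p x) :
    ∀ p' : Fin n → ℝ, IsDist p' → (∀ x, 0 < p' x) →
      fBA ρ s lam p p' ≤ fBA ρ s lam p p := by
  intro p' hp' hppos'
  rw [fBA_eq hρ s lam hppos hppos', fBA_eq hρ s lam hppos hppos]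
  have h := qRelEnt_sum_le_cRelEnt hρ hppos hppos' hp.2
  have hq : qRelEnt (∑ x, (p x : ℂ) • ρ x) (∑ x, (p x : ℂ) • ρ x) = 0 := by simp [qRelEnt]
  have hc : cRelEnt p p = 0 := by simp [cRelEnt]
  rw [hq, hc]
  linarith
end
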